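/- arXiv:1809.02022 — 5 statements merged into one kernel-verified Lean document; each statement's English description precedes it below -/
import Mathlib

section
/- Let X and Y be finite nonempty types, let W : X → PMF(Y) be a channel, let M ≥ 1, let f : Fin M → X be an encoder and g : Y → Fin M a decoder. Let the message U be uniformly distributed on Fin M and, conditionally on U = m, let the output Y be distributed according to W(f(m)). Define the output distribution P_Y(y) = (1/M)·∑_{m} W(f(m))(y), the information density i(x;y) = log(W(x)(y)) − log(P_Y(y)) (defined arbitrarily when W(x)(y) = 0 or P_Y(y) = 0, which happens with probability zero under the code distribution), and the average error probability Pe = Pr[g(Y) ≠ U]. Then for every γ > 0: Pe ≥ Pr[ i(f(U);Y) ≤ log M − γ ] − exp(−γ). (This is the single-shot form of the Verdú–Han lemma; the blocklength-N form Pe ≥ Pr[(1/N)·i ≤ R − γ] − e^{−γN} follows by taking X to be the N-fold alphabet and M = ⌈2^{NR}⌉.) -/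
open Finset Real

open scoped Classical in
/-- **Verdú–Han lemma (single-shot form).**
`W` is a channel from a finite input alphabet `X` to a finite output alphabet `Y`,
`f` is an encoder for `M ≥ 1` messages and `g` a decoder.  The joint code
distribution puts mass `P m y = (1/M) · W(f m)(y)` on message–output pairs,
`PY` is the output distribution, `i` is the information density (specified only
where both `W x y` and `PY y` are nonzero, and arbitrary elsewhere), and `Pe`
is the average error probability.  Then for every `γ > 0`,
`Pe ≥ Pr[i(f(U);Y) ≤ log M − γ] − exp(−γ)`. -/
theorem verdu_han_single_shot
    {X Y : Type*} [Fintype X] [Fintype Y] [Nonempty X] [Nonempty Y]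
    (W : X → PMF Y) (M : ℕ) (hM : 1 ≤ M)
    (f : Fin M → X) (g : Y → Fin M)
    (P : Fin M → Y → ℝ)
    (hP : ∀ m y, P m y = (1 / M) * ((W (f m)) y).toReal)
    (PY : Y → ℝ)
    (hPY : ∀ y, PY y = ∑ m : Fin M, P m y)
    (i : X → Y → ℝ)
    (hi : ∀ x y, (W x) y ≠ 0 → PY y ≠ 0 →
      i x y = Real.log (((W x) y).toReal) - Real.log (PY y))
    (Pe : ℝ)
    (hPe : Pe = ∑ m : Fin M, ∑ y : Y, if g y ≠ m then P m y else 0)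
    (γ : ℝ) (hγ : 0 < γ) :
    Pe ≥ (∑ m : Fin M, ∑ y : Y,
            if i (f m) y ≤ Real.log M - γ then P m y else 0)
          - Real.exp (-γ) := by
  have hM0 : (0 : ℝ) < M := by exact_mod_cast hM
  have hP0 : ∀ m y, 0 ≤ P m y := fun m y => by rw [hP]; positivity
  have hPY0 : ∀ y, 0 ≤ PY y := fun y => by
    rw [hPY]; exact Finset.sum_nonneg fun m _ => hP0 m y
  have hW1 : ∀ x, ∑ y, ((W x) y).toReal = 1 := fun x => by
    rw [← ENNReal.toReal_sum fun y _ => (W x).apply_ne_top y, ← tsum_fintype (L := .unconditional Y),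
      (W x).tsum_coe, ENNReal.toReal_one]
  have hPY1 : ∑ y, PY y = 1 := by
    simp_rw [hPY, hP]
    rw [Finset.sum_comm]
    simp_rw [← Finset.mul_sum, hW1]
    simp [hM0.ne']
  have low_density : ∀ m y, i (f m) y ≤ Real.log M - γ → P m y ≤ Real.exp (-γ) * PY y := by
    intro m y h
    rcases (hP0 m y).eq_or_lt with h0 | hpos
    · rw [← h0]; exact mul_nonneg (Real.exp_pos _).le (hPY0 y)
    have hPYpos : 0 < PY y := hpos.trans_le <| by
      rw [hPY]; exact Finset.single_le_sum (fun k _ => hP0 k y) (Finset.mem_univ m)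
    have hWne : (W (f m)) y ≠ 0 := by
      intro h0; rw [hP, h0] at hpos; simp at hpos
    have hWpos : 0 < ((W (f m)) y).toReal :=
      ENNReal.toReal_pos hWne ((W (f m)).apply_ne_top y)
    rw [hi _ _ hWne hPYpos.ne'] at h
    have hlog : Real.log (P m y) ≤ Real.log (Real.exp (-γ) * PY y) := by
      rw [hP, Real.log_mul (by positivity) hWpos.ne', one_div, Real.log_inv,
        Real.log_mul (Real.exp_pos _).ne' hPYpos.ne', Real.log_exp]
      linarith
    exact (Real.log_le_log_iff hpos (by positivity)).1 hlog
  have hcorrect : ∑ m : Fin M, ∑ y : Y, (if g y = m then Real.exp (-γ) * PY y else 0)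
      = Real.exp (-γ) := by
    rw [Finset.sum_comm]
    simp [← Finset.mul_sum, hPY1]
  rw [ge_iff_le, sub_le_iff_le_add, hPe]
  rw [← hcorrect]
  simp_rw [← Finset.sum_add_distrib]
  refine Finset.sum_le_sum fun m _ => Finset.sum_le_sum fun y _ => ?_
  by_cases hg : g y = m
  · simp only [hg, ne_eq, not_true_eq_false, if_false, if_true, zero_add]
    split_ifs with h
    · exact low_density m y h
    · exact mul_nonneg (Real.exp_pos _).le (hPY0 y)
  · simp only [hg, ne_eq, not_false_eq_true, if_true, if_false, add_zero]
    split_ifs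
    · exact le_rfl
    · exact hP0 m y
end

section
/- Let η₁, η₂, p_z ∈ [0,1]. Let (X₁, X̃₁) be a pair of {0,1}-valued random variables with joint probability mass function P(0,0) = P(1,1) = η₁/2, P(0,1) = P(1,0) = (1−η₁)/2, let (X₂, X̃₂) be an independent pair with the same form of joint distribution but with parameter η₂, and let Z be a Bernoulli(p_z) random variable independent of (X₁, X̃₁, X₂, X̃₂). Then H(X₁ ⊕ Z | X̃₁ ⊕ X̃₂, X₂) = H_sum(p_z, η₁(1−η₂) + η₂(1−η₁)), where ⊕ denotes modulo-2 addition (XOR). -/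
/-- Shannon entropy `H(f)` (natural logarithm, convention `0·log 0 = 0`) of a
discrete random variable `f` on a finite sample space carrying the probability
mass function `μ`. -/
noncomputable def shannonEntropy {Ω V : Type*} [Fintype Ω] [Fintype V] [DecidableEq V]
    (μ : Ω → ℝ) (f : Ω → V) : ℝ :=
  ∑ v : V, Real.negMulLog (∑ ω ∈ Finset.univ.filter (fun ω => f ω = v), μ ω)

/-- Conditional Shannon entropy `H(f | g) = H(f, g) − H(g)`. -/
noncomputable def condShannonEntropy {Ω V W : Type*} [Fintype Ω] [Fintype V] [DecidableEq V]
    [Fintype W] [DecidableEq W] (μ : Ω → ℝ) (f : Ω → V) (g : Ω → W) : ℝ :=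
  shannonEntropy μ (fun ω => (f ω, g ω)) - shannonEntropy μ g

/-- `H_sum(p,q) := H_b(p(1−q)+(1−p)q)`, where `H_b` is the binary entropy. -/
noncomputable def Hsum (p q : ℝ) : ℝ := Real.binEntropy (p * (1 - q) + (1 - p) * q)

/-- Grouping: splitting an atom of mass `c` into masses `t * c` and `(1 - t) * c` raises
`negMulLog` by `c` times the binary entropy of `t`. -/
theorem negMulLog_mul_add_negMulLog_one_sub_mul (t c : ℝ) :
    Real.negMulLog (t * c) + Real.negMulLog ((1 - t) * c) =
      c * Real.binEntropy t + Real.negMulLog c := by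
  rw [Real.negMulLog_mul, Real.negMulLog_mul, Real.binEntropy_eq_negMulLog_add_negMulLog_one_sub]
  ring

/-- Let `η₁, η₂, p_z ∈ [0,1]`.  `(X₁, X̃₁)` is a pair of binary random variables with
joint pmf `P(0,0) = P(1,1) = η₁/2`, `P(0,1) = P(1,0) = (1−η₁)/2`, `(X₂, X̃₂)` is an
independent pair of the same form with parameter `η₂`, and `Z ~ Ber(p_z)` is
independent of all of them (independence is encoded by the product pmf `μ` on the
sample space `((Bool × Bool) × (Bool × Bool)) × Bool`, whose coordinates are
`(((X₁, X̃₁), (X₂, X̃₂)), Z)`).  Then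
`H(X₁ ⊕ Z | X̃₁ ⊕ X̃₂, X₂) = H_sum(p_z, η₁(1−η₂) + η₂(1−η₁))`. -/
theorem condEntropy_xor_bernoulli_eq_Hsum (η₁ η₂ pz : ℝ)
    (hη₁0 : 0 ≤ η₁) (hη₁1 : η₁ ≤ 1) (hη₂0 : 0 ≤ η₂) (hη₂1 : η₂ ≤ 1)
    (hpz0 : 0 ≤ pz) (hpz1 : pz ≤ 1)
    (P₁ P₂ : Bool × Bool → ℝ)
    (h₁00 : P₁ (false, false) = η₁ / 2) (h₁11 : P₁ (true, true) = η₁ / 2)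
    (h₁01 : P₁ (false, true) = (1 - η₁) / 2) (h₁10 : P₁ (true, false) = (1 - η₁) / 2)
    (h₂00 : P₂ (false, false) = η₂ / 2) (h₂11 : P₂ (true, true) = η₂ / 2)
    (h₂01 : P₂ (false, true) = (1 - η₂) / 2) (h₂10 : P₂ (true, false) = (1 - η₂) / 2)
    (PZ : Bool → ℝ) (hZ1 : PZ true = pz) (hZ0 : PZ false = 1 - pz)
    (μ : ((Bool × Bool) × (Bool × Bool)) × Bool → ℝ)
    (hμ : ∀ ω, μ ω = P₁ ω.1.1 * P₂ ω.1.2 * PZ ω.2) :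
    condShannonEntropy μ (fun ω => Bool.xor ω.1.1.1 ω.2)
        (fun ω => (Bool.xor ω.1.1.2 ω.1.2.2, ω.1.2.1)) =
      Hsum pz (η₁ * (1 - η₂) + η₂ * (1 - η₁)) := by
  set t := pz * (1 - (η₁ * (1 - η₂) + η₂ * (1 - η₁))) +
    (1 - pz) * (η₁ * (1 - η₂) + η₂ * (1 - η₁)) with ht
  have joint_pmf (v : Bool × (Bool × Bool)) :
      ∑ ω ∈ Finset.univ.filter (fun ω : ((Bool × Bool) × (Bool × Bool)) × Bool =>
        (Bool.xor ω.1.1.1 ω.2, (Bool.xor ω.1.1.2 ω.1.2.2, ω.1.2.1)) = v), μ ω =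
      if Bool.xor v.1 (Bool.xor v.2.1 v.2.2) then t * (1 / 4) else (1 - t) * (1 / 4) := by
    obtain ⟨_ | _, _ | _, _ | _⟩ := v <;>
      simp [Finset.sum_filter, Fintype.sum_prod_type, hμ, h₁00, h₁01, h₁10, h₁11,
        h₂00, h₂01, h₂10, h₂11, hZ0, hZ1, ht] <;> ring
  have marginal_pmf (w : Bool × Bool) :
      ∑ ω ∈ Finset.univ.filter (fun ω : ((Bool × Bool) × (Bool × Bool)) × Bool =>
        (Bool.xor ω.1.1.2 ω.1.2.2, ω.1.2.1) = w), μ ω = 1 / 4 := by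
    obtain ⟨_ | _, _ | _⟩ := w <;>
      simp [Finset.sum_filter, Fintype.sum_prod_type, hμ, h₁00, h₁01, h₁10, h₁11,
        h₂00, h₂01, h₂10, h₂11, hZ0, hZ1] <;> ring
  have grouping := negMulLog_mul_add_negMulLog_one_sub_mul t (1 / 4)
  simp only [condShannonEntropy, shannonEntropy, joint_pmf, marginal_pmf, Hsum, ← ht]
  simp only [Fintype.sum_prod_type, Fintype.sum_bool, Bool.xor_true, Bool.xor_false,
    Bool.not_true, Bool.not_false, Bool.false_eq_true, if_true, if_false]
  linarith
end

section
/- Let n_d, n_c ≥ 0 and p ∈ [0,1] be real numbers, and define A := 2(1−p)·n_d + p·((n_d − n_c)⁺ + max(n_d, n_c)) and B := 2(1−p)·n_d + 2p·max{(n_d − n_c)⁺, n_c}. If 3n_c ≤ 2n_d then min{A, B} = B, and if 3n_c ≥ 2n_d then min{A, B} = A. In particular, the sum capacity of the bursty interference channel with global CSIRT and fully correlated interference states equals 2(n_d − p·n_c) for 2n_c ≤ n_d, equals 2((1−p)·n_d + p·n_c) for n_d ≤ 2n_c ≤ (4/3)·n_d, equals 2(1−p)·n_d + p·(2n_d − n_c)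 for (2/3)·n_d ≤ n_c ≤ n_d, and equals 2(1−p)·n_d + p·n_c for n_d ≤ n_c ≤ 2n_d. -/
theorem two_mul_max_le_add_max {x y : ℝ} (hy : 0 ≤ y) (h : 3 * y ≤ 2 * x) :
    2 * max (max (x - y) 0) y ≤ max (x - y) 0 + max x y := by
  have hyx : y ≤ x := by linarith
  rw [max_eq_left (sub_nonneg.2 hyx), max_eq_left hyx]
  rcases max_cases (x - y) y with ⟨h', _⟩ | ⟨h', _⟩ <;> rw [h'] <;> linarith

theorem add_max_le_two_mul_max {x y : ℝ} (hy : 0 ≤ y) (h : 2 * x ≤ 3 * y) :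
    max (x - y) 0 + max x y ≤ 2 * max (max (x - y) 0) y := by
  have hle := le_max_right (max (x - y) 0) y
  rcases le_total y x with hyx | hxy
  · rw [max_eq_left (sub_nonneg.2 hyx)] at hle ⊢
    rw [max_eq_left hyx]
    linarith
  · rw [max_eq_right (sub_nonpos.2 hxy)] at hle ⊢
    rw [max_eq_right hxy]
    linarith

/-- Let `n_d, n_c ≥ 0` and `p ∈ [0,1]`, and let
`A := 2(1−p)n_d + p((n_d − n_c)⁺ + max(n_d, n_c))` and
`B := 2(1−p)n_d + 2p·max{(n_d − n_c)⁺, n_c}` be the two converse bounds for global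
CSIRT with fully correlated interference states (here `x⁺ = max(x,0)`).  If
`3n_c ≤ 2n_d` then `min{A,B} = B`, and if `3n_c ≥ 2n_d` then `min{A,B} = A`.
In particular, the sum capacity `min{A,B}` equals `2(n_d − p·n_c)` for `2n_c ≤ n_d`,
equals `2((1−p)n_d + p·n_c)` for `n_d ≤ 2n_c ≤ (4/3)n_d`, equals
`2(1−p)n_d + p(2n_d − n_c)` for `(2/3)n_d ≤ n_c ≤ n_d`, and equals
`2(1−p)n_d + p·n_c` for `n_d ≤ n_c ≤ 2n_d`. -/
theorem globalCSIRT_corr_sumCapacity (nd nc p : ℝ)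
    (hnd0 : 0 ≤ nd) (hnc0 : 0 ≤ nc) (hp0 : 0 ≤ p) (hp1 : p ≤ 1) :
    (3 * nc ≤ 2 * nd →
      min (2 * (1 - p) * nd + p * (max (nd - nc) 0 + max nd nc))
          (2 * (1 - p) * nd + 2 * p * max (max (nd - nc) 0) nc) =
        2 * (1 - p) * nd + 2 * p * max (max (nd - nc) 0) nc) ∧
    (2 * nd ≤ 3 * nc →
      min (2 * (1 - p) * nd + p * (max (nd - nc) 0 + max nd nc))
          (2 * (1 - p) * nd + 2 * p * max (max (nd - nc) 0) nc) =
        2 * (1 - p) * nd + p * (max (nd - nc) 0 + max nd nc)) ∧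
    (2 * nc ≤ nd →
      min (2 * (1 - p) * nd + p * (max (nd - nc) 0 + max nd nc))
          (2 * (1 - p) * nd + 2 * p * max (max (nd - nc) 0) nc) =
        2 * (nd - p * nc)) ∧
    (nd ≤ 2 * nc → 2 * nc ≤ (4 / 3) * nd →
      min (2 * (1 - p) * nd + p * (max (nd - nc) 0 + max nd nc))
          (2 * (1 - p) * nd + 2 * p * max (max (nd - nc) 0) nc) =
        2 * ((1 - p) * nd + p * nc)) ∧
    ((2 / 3) * nd ≤ nc → nc ≤ nd →
      min (2 * (1 - p) * nd + p * (max (nd - nc) 0 + max nd nc))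
          (2 * (1 - p) * nd + 2 * p * max (max (nd - nc) 0) nc) =
        2 * (1 - p) * nd + p * (2 * nd - nc)) ∧
    (nd ≤ nc → nc ≤ 2 * nd →
      min (2 * (1 - p) * nd + p * (max (nd - nc) 0 + max nd nc))
          (2 * (1 - p) * nd + 2 * p * max (max (nd - nc) 0) nc) =
        2 * (1 - p) * nd + p * nc) := by
  have hB : 3 * nc ≤ 2 * nd →
      min (2 * (1 - p) * nd + p * (max (nd - nc) 0 + max nd nc))
          (2 * (1 - p) * nd + 2 * p * max (max (nd - nc) 0) nc) =
        2 * (1 - p) * nd + 2 * p * max (max (nd - nc) 0) nc := by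
    intro h
    refine min_eq_right ?_
    linarith [mul_le_mul_of_nonneg_left (two_mul_max_le_add_max hnc0 h) hp0]
  have hA : 2 * nd ≤ 3 * nc →
      min (2 * (1 - p) * nd + p * (max (nd - nc) 0 + max nd nc))
          (2 * (1 - p) * nd + 2 * p * max (max (nd - nc) 0) nc) =
        2 * (1 - p) * nd + p * (max (nd - nc) 0 + max nd nc) := by
    intro h
    refine min_eq_left ?_
    linarith [mul_le_mul_of_nonneg_left (add_max_le_two_mul_max hnc0 h) hp0]
  refine ⟨hB, hA, fun h => ?_, fun h₁ h₂ => ?_, fun h₁ h₂ => ?_, fun h₁ h₂ => ?_⟩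
  · rw [hB (by linarith), max_eq_left (by linarith : (0 : ℝ) ≤ nd - nc),
      max_eq_left (by linarith)]
    ring
  · rw [hB (by linarith), max_eq_right (max_le (by linarith) hnc0)]
    ring
  · rw [hA (by linarith), max_eq_left (sub_nonneg.2 h₂), max_eq_left h₂]
    ring
  · rw [hA (by linarith), max_eq_right (sub_nonpos.2 h₁), max_eq_right h₁, zero_add]
end

section
/- Let n_d, n_c, p be real numbers with 0 ≤ 2n_c ≤ n_d and 0 ≤ p ≤ 1. Then 2(n_d − p·n_c) is the greatest element of the set { R + (1−p)·(Δ₁ + Δ₂) : R ≥ 0, Δ₁ ≥ 0, Δ₂ ≥ 0, R ≤ 2(n_d − n_c), R + Δ₁ + Δ₂ ≤ 2n_d, R + Δ₁ ≤ 2n_d − n_c, R + Δ₂ ≤ 2n_d − n_c }; the maximum is attained at R = 2(n_d − n_c), Δ₁ = Δ₂ = n_c. -/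
/-- For `0 ≤ 2n_c ≤ n_d` (very weak interference) and `0 ≤ p ≤ 1`, the value
`2(n_d − p·n_c)` is the greatest element of the set of average sum rates
`R + (1−p)(Δ₁ + Δ₂)` over the local-CSIR quasi-static rate region
`{R ≥ 0, Δ₁ ≥ 0, Δ₂ ≥ 0, R ≤ 2(n_d − n_c), R + Δ₁ + Δ₂ ≤ 2n_d,
R + Δ₁ ≤ 2n_d − n_c, R + Δ₂ ≤ 2n_d − n_c}`; the maximum is attained at
`R = 2(n_d − n_c)`, `Δ₁ = Δ₂ = n_c`. -/
theorem avgSumCapacity_VWI (nd nc p : ℝ)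
    (hnc0 : 0 ≤ 2 * nc) (hncnd : 2 * nc ≤ nd) (hp0 : 0 ≤ p) (hp1 : p ≤ 1) :
    IsGreatest {x : ℝ | ∃ R Δ₁ Δ₂ : ℝ,
        0 ≤ R ∧ 0 ≤ Δ₁ ∧ 0 ≤ Δ₂ ∧
        R ≤ 2 * (nd - nc) ∧
        R + Δ₁ + Δ₂ ≤ 2 * nd ∧
        R + Δ₁ ≤ 2 * nd - nc ∧
        R + Δ₂ ≤ 2 * nd - nc ∧
        x = R + (1 - p) * (Δ₁ + Δ₂)}
      (2 * (nd - p * nc)) ∧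
    2 * (nd - nc) + (1 - p) * (nc + nc) = 2 * (nd - p * nc) := by
  refine ⟨⟨⟨2 * (nd - nc), nc, nc, ?_, ?_, ?_, ?_, ?_, ?_, ?_, ?_⟩, ?_⟩, by ring⟩
  any_goals linarith
  rintro x ⟨R, Δ₁, Δ₂, -, -, -, hR, hsum, -, -, rfl⟩
  calc R + (1 - p) * (Δ₁ + Δ₂) = p * R + (1 - p) * (R + Δ₁ + Δ₂) := by ring
    _ ≤ p * (2 * (nd - nc)) + (1 - p) * (2 * nd) := by
      have := sub_nonneg.2 hp1
      gcongr
    _ = 2 * (nd - p * nc) := by ring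
end

section
/- Let n_d, n_c, p be real numbers with 0 ≤ n_d ≤ n_c ≤ 2n_d and 0 ≤ p ≤ 1/2. Then 2(1−2p)·n_d + 2p·n_c is the greatest element of the set { R + (1−p)·(Δ₁ + Δ₂) : R ≥ 0, Δ₁ ≥ 0, Δ₂ ≥ 0, R ≤ n_c, R + Δ₁ + Δ₂ ≤ 2n_d, R + Δ₁ ≤ n_c, R + Δ₂ ≤ n_c }; the maximum is attained at R = 2(n_c − n_d), Δ₁ = Δ₂ = 2n_d − n_c. -/
/-- For `0 ≤ n_d ≤ n_c ≤ 2n_d` (strong interference) and `0 ≤ p ≤ 1/2`, the value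
`2(1−2p)n_d + 2p·n_c` is the greatest element of the set of average sum rates
`R + (1−p)(Δ₁ + Δ₂)` over the local-CSIR quasi-static rate region
`{R ≥ 0, Δ₁ ≥ 0, Δ₂ ≥ 0, R ≤ n_c, R + Δ₁ + Δ₂ ≤ 2n_d, R + Δ₁ ≤ n_c, R + Δ₂ ≤ n_c}`;
the maximum is attained at `R = 2(n_c − n_d)`, `Δ₁ = Δ₂ = 2n_d − n_c`. -/
theorem avgSumCapacity_SI (nd nc p : ℝ)
    (hnd0 : 0 ≤ nd) (hndnc : nd ≤ nc) (hnc2 : nc ≤ 2 * nd)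
    (hp0 : 0 ≤ p) (hp : p ≤ 1 / 2) :
    IsGreatest {x : ℝ | ∃ R Δ₁ Δ₂ : ℝ,
        0 ≤ R ∧ 0 ≤ Δ₁ ∧ 0 ≤ Δ₂ ∧
        R ≤ nc ∧
        R + Δ₁ + Δ₂ ≤ 2 * nd ∧
        R + Δ₁ ≤ nc ∧
        R + Δ₂ ≤ nc ∧
        x = R + (1 - p) * (Δ₁ + Δ₂)}
      (2 * (1 - 2 * p) * nd + 2 * p * nc) ∧
    2 * (nc - nd) + (1 - p) * ((2 * nd - nc) + (2 * nd - nc)) =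
      2 * (1 - 2 * p) * nd + 2 * p * nc := by
  have value_eq : 2 * (nc - nd) + (1 - p) * ((2 * nd - nc) + (2 * nd - nc)) =
      2 * (1 - 2 * p) * nd + 2 * p * nc := by ring
  refine ⟨⟨⟨2 * (nc - nd), 2 * nd - nc, 2 * nd - nc, ?_, ?_, ?_, ?_, ?_, ?_, ?_, value_eq.symm⟩, ?_⟩,
    value_eq⟩
  iterate 7 linarith
  rintro x ⟨R, Δ₁, Δ₂, -, -, -, -, hsum, h₁, h₂, rfl⟩
  calc R + (1 - p) * (Δ₁ + Δ₂)
      = (1 - 2 * p) * (R + Δ₁ + Δ₂) + p * ((R + Δ₁) + (R + Δ₂)) := by ring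
    _ ≤ (1 - 2 * p) * (2 * nd) + p * (nc + nc) := by
        have : 0 ≤ 1 - 2 * p := by linarith
        gcongr
    _ = 2 * (1 - 2 * p) * nd + 2 * p * nc := by ring
end
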